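/- arXiv:1109.3577 — 5 statements merged into one kernel-verified Lean document; each statement's English description precedes it below -/
import Mathlib

section
/- Let u(x₁,x₂) = ½(√3·x₁² + 2·x₁·x₂ + √3·x₂²). For every T ≥ 0 and every pair of differentiable functions y₁, y₂ : ℝ → ℝ with continuous derivatives such that y₁'(t) = y₂(t) for all t ∈ [0,T], one has ∫₀^T ( ½(y₁(t)² + y₂(t)²) + ½·(y₂'(t))² ) dt ≥ u(y₁(0), y₂(0)) − u(y₁(T), y₂(T)). (Verification inequality: the cost of any admissible trajectory over [0,T] is at least the decrease of u along it.) -/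
/-- The value function of the LQR problem from the paper. -/
noncomputable def lqrValue (x₁ x₂ : ℝ) : ℝ :=
  1/2 * (Real.sqrt 3 * x₁^2 + 2 * x₁ * x₂ + Real.sqrt 3 * x₂^2)

/-- The derivative of `lqrValue` along a differentiable curve. -/
theorem HasDerivAt.lqrValue {y₁ y₂ : ℝ → ℝ} {v a t : ℝ}
    (h₁ : HasDerivAt y₁ v t) (h₂ : HasDerivAt y₂ a t) :
    HasDerivAt (fun s => _root_.lqrValue (y₁ s) (y₂ s))
      (√3 * y₁ t * v + v * y₂ t + y₁ t * a + √3 * y₂ t * a) t := by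
  unfold _root_.lqrValue
  refine ((((h₁.pow 2).const_mul (√3)).add ((h₁.const_mul 2).mul h₂)
    |>.add ((h₂.pow 2).const_mul (√3))).const_mul (1 / 2 : ℝ)).congr_deriv ?_
  push_cast
  ring

/-- The Hamilton–Jacobi–Bellman inequality for `lqrValue`, by completing the square. -/
theorem neg_deriv_lqrValue_le_cost (x₁ x₂ a : ℝ) :
    -(√3 * x₁ * x₂ + x₂ * x₂ + x₁ * a + √3 * x₂ * a)
      ≤ 1 / 2 * (x₁ ^ 2 + x₂ ^ 2) + 1 / 2 * a ^ 2 := by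
  have h : √3 ^ 2 = (3 : ℝ) := Real.sq_sqrt (by norm_num)
  linear_combination (1 / 2 : ℝ) * sq_nonneg (a + x₁ + √3 * x₂) + (1 / 2) * x₂ ^ 2 * h

/-- Verification inequality: for any `T ≥ 0` and any `C¹` trajectory `(y₁, y₂)` with
`y₁' = y₂` on `[0,T]`, the running cost over `[0,T]` is at least the decrease of the
value function `u` along the trajectory. -/
theorem lqr_verification_inequality (T : ℝ) (hT : 0 ≤ T) (y₁ y₂ : ℝ → ℝ)
    (hy₁ : Differentiable ℝ y₁) (hy₂ : Differentiable ℝ y₂)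
    (hy₁' : Continuous (deriv y₁)) (hy₂' : Continuous (deriv y₂))
    (hsys : ∀ t ∈ Set.Icc (0:ℝ) T, deriv y₁ t = y₂ t) :
    (∫ t in (0:ℝ)..T, (1/2 * ((y₁ t)^2 + (y₂ t)^2) + 1/2 * (deriv y₂ t)^2))
      ≥ lqrValue (y₁ 0) (y₂ 0) - lqrValue (y₁ T) (y₂ T) := by
  have hc₁ := hy₁.continuous
  have hc₂ := hy₂.continuous
  have hcont : Continuous fun t => √3 * y₁ t * deriv y₁ t + deriv y₁ t * y₂ t
      + y₁ t * deriv y₂ t + √3 * y₂ t * deriv y₂ t := by fun_prop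
  have hftc := intervalIntegral.integral_eq_sub_of_hasDerivAt
    (fun t _ => (hy₁ t).hasDerivAt.lqrValue (hy₂ t).hasDerivAt)
    (hcont.intervalIntegrable 0 T)
  rw [ge_iff_le, ← neg_sub, ← hftc, ← intervalIntegral.integral_neg]
  refine intervalIntegral.integral_mono_on hT (hcont.neg.intervalIntegrable 0 T)
    (Continuous.intervalIntegrable (by fun_prop) 0 T) fun t ht => ?_
  rw [hsys t ht]
  exact neg_deriv_lqrValue_le_cost (y₁ t) (y₂ t) (deriv y₂ t)
end

section
/- Let u(x₁,x₂) = ½(√3·x₁² + 2·x₁·x₂ + √3·x₂²). If y₁, y₂ : ℝ → ℝ are differentiable and satisfy the closed-loop system y₁'(t) = y₂(t) and y₂'(t) = −(y₁(t) + √3·y₂(t)) for all t ≥ 0, then the function t ↦ ½(y₁(t)² + y₂(t)²) + ½(y₁(t) + √3·y₂(t))² is integrable on [0,∞) and ∫₀^∞ ( ½(y₁(t)² + y₂(t)²) + ½(y₁(t) + √3·y₂(t))² ) dt = u(y₁(0), y₂(0)). (The feedback a*(x) = −(x₁ + √3·x₂) realizes the cost u(x) exactly.) -/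
open MeasureTheory

theorem lqrValue_nonneg (a b : ℝ) : 0 ≤ lqrValue a b := by
  have hs : (1 : ℝ) ≤ √3 := Real.one_le_sqrt.2 (by norm_num)
  unfold lqrValue
  nlinarith [sq_nonneg (a + b), mul_nonneg (sub_nonneg.2 hs) (sq_nonneg a),
    mul_nonneg (sub_nonneg.2 hs) (sq_nonneg b)]

theorem half_lqrValue_le_runningCost (a b : ℝ) :
    1/2 * lqrValue a b ≤ 1/2 * (a^2 + b^2) + 1/2 * (a + √3 * b)^2 := by
  have hs : √3 ≤ 2 := Real.sqrt_le_iff.2 (by norm_num)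
  unfold lqrValue
  nlinarith [sq_nonneg (a + b), sq_nonneg (a + √3 * b), sq_nonneg (a + 2 * √3 * b), sq_nonneg b,
    mul_nonneg (sub_nonneg.2 hs) (sq_nonneg a), mul_nonneg (sub_nonneg.2 hs) (sq_nonneg b),
    Real.sq_sqrt (show (0 : ℝ) ≤ 3 by norm_num)]

/-- Along the closed loop, the value function decreases at the rate of the running cost. -/
theorem hasDerivAt_lqrValue_closedLoop {y₁ y₂ : ℝ → ℝ} {t : ℝ} (h₁ : HasDerivAt y₁ (y₂ t) t)
    (h₂ : HasDerivAt y₂ (-(y₁ t + √3 * y₂ t)) t) :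
    HasDerivAt (fun t => lqrValue (y₁ t) (y₂ t))
      (-(1/2 * ((y₁ t)^2 + (y₂ t)^2) + 1/2 * (y₁ t + √3 * y₂ t)^2)) t := by
  unfold lqrValue
  have h := ((((h₁.pow 2).const_mul √3).add ((h₁.const_mul 2).mul h₂)).add
    ((h₂.pow 2).const_mul √3)).const_mul (1/2 : ℝ)
  refine h.congr_deriv ?_
  have hs : √3 ^ 2 = (3 : ℝ) := Real.sq_sqrt (by norm_num)
  norm_num
  linear_combination (-1/2 * (y₂ t)^2) * hs

/-- A nonnegative function with `V' ≤ -c V` on `[0, ∞)`, where `c > 0`, tends to zero. -/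
theorem tendsto_zero_of_hasDerivAt_le_neg_mul {V V' : ℝ → ℝ} {c : ℝ} (hc : 0 < c)
    (hV : ∀ t, 0 ≤ t → 0 ≤ V t) (hd : ∀ t, 0 ≤ t → HasDerivAt V (V' t) t)
    (hle : ∀ t, 0 ≤ t → V' t ≤ -(c * V t)) :
    Filter.Tendsto V Filter.atTop (nhds 0) := by
  have hderiv : ∀ t, 0 ≤ t → HasDerivAt (fun t => Real.exp (c * t) * V t)
      (Real.exp (c * t) * (c * V t + V' t)) t := fun t ht =>
    ((((hasDerivAt_id t).const_mul c).exp).mul (hd t ht)).congr_deriv (by simp; ring)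
  have hanti : AntitoneOn (fun t => Real.exp (c * t) * V t) (Set.Ici 0) := by
    refine antitoneOn_of_hasDerivWithinAt_nonpos (convex_Ici 0)
      (fun t ht => (hderiv t ht).continuousAt.continuousWithinAt)
      (fun t ht => (hderiv t (interior_subset ht)).hasDerivWithinAt) fun t ht => ?_
    exact mul_nonpos_of_nonneg_of_nonpos (Real.exp_pos _).le
      (by linarith [hle t (interior_subset ht)])
  have hbound : ∀ t, 0 ≤ t → V t ≤ V 0 * Real.exp (-(c * t)) := fun t ht => by
    have h := hanti (Set.self_mem_Ici) ht ht
    simp only [mul_zero, Real.exp_zero, one_mul] at h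
    rw [Real.exp_neg, ← div_eq_mul_inv, le_div_iff₀ (Real.exp_pos _)]
    linarith
  have hlim : Filter.Tendsto (fun t => V 0 * Real.exp (-(c * t))) Filter.atTop (nhds 0) := by
    simpa using (Real.tendsto_exp_neg_atTop_nhds_zero.comp
      (Filter.tendsto_id.const_mul_atTop hc)).const_mul (V 0)
  refine squeeze_zero' ?_ ?_ hlim
  · filter_upwards [Filter.eventually_ge_atTop 0] with t ht using hV t ht
  · filter_upwards [Filter.eventually_ge_atTop 0] with t ht using hbound t ht

/-- Along any solution of the closed-loop system `y₁' = y₂`, `y₂' = -(y₁ + √3 y₂)`,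
the running cost is integrable on `[0,∞)` and its integral equals `u(y₁(0), y₂(0))`:
the feedback `a*(x) = -(x₁ + √3 x₂)` realizes the cost `u(x)` exactly. -/
theorem lqr_feedback_realizes_value (y₁ y₂ : ℝ → ℝ)
    (hy₁ : Differentiable ℝ y₁) (hy₂ : Differentiable ℝ y₂)
    (h1 : ∀ t : ℝ, 0 ≤ t → deriv y₁ t = y₂ t)
    (h2 : ∀ t : ℝ, 0 ≤ t → deriv y₂ t = -(y₁ t + Real.sqrt 3 * y₂ t)) :
    IntegrableOn
      (fun t => 1/2 * ((y₁ t)^2 + (y₂ t)^2) + 1/2 * (y₁ t + Real.sqrt 3 * y₂ t)^2)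
      (Set.Ici (0:ℝ)) ∧
    ∫ t in Set.Ici (0:ℝ),
        (1/2 * ((y₁ t)^2 + (y₂ t)^2) + 1/2 * (y₁ t + Real.sqrt 3 * y₂ t)^2)
      = lqrValue (y₁ 0) (y₂ 0) := by
  have hd : ∀ t : ℝ, 0 ≤ t → HasDerivAt (fun t => lqrValue (y₁ t) (y₂ t))
      (-(1/2 * ((y₁ t)^2 + (y₂ t)^2) + 1/2 * (y₁ t + √3 * y₂ t)^2)) t := fun t ht =>
    hasDerivAt_lqrValue_closedLoop (h1 t ht ▸ (hy₁ t).hasDerivAt) (h2 t ht ▸ (hy₂ t).hasDerivAt)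
  have hlim : Filter.Tendsto (fun t => lqrValue (y₁ t) (y₂ t)) Filter.atTop (nhds 0) :=
    tendsto_zero_of_hasDerivAt_le_neg_mul one_half_pos (fun t _ => lqrValue_nonneg _ _) hd
      fun t _ => neg_le_neg (half_lqrValue_le_runningCost _ _)
  have hd' : ∀ t ∈ Set.Ici (0 : ℝ), HasDerivAt (fun t => -lqrValue (y₁ t) (y₂ t))
      (1/2 * ((y₁ t)^2 + (y₂ t)^2) + 1/2 * (y₁ t + √3 * y₂ t)^2) t := fun t ht =>
    (hd t ht).neg.congr_deriv (neg_neg _)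
  have hpos : ∀ t ∈ Set.Ioi (0 : ℝ),
      0 ≤ 1/2 * ((y₁ t)^2 + (y₂ t)^2) + 1/2 * (y₁ t + √3 * y₂ t)^2 := fun t _ => by positivity
  rw [integrableOn_Ici_iff_integrableOn_Ioi, integral_Ici_eq_integral_Ioi]
  refine ⟨integrableOn_Ioi_deriv_of_nonneg' hd' hpos hlim.neg, ?_⟩
  rw [integral_Ioi_of_hasDerivAt_of_nonneg' hd' hpos hlim.neg]
  simp
end

section
/- For the Fan dynamics f(x,a) = |x₁ + x₂ + 0.1|·a with controls a in the closed unit ball of ℝ² and target the line {x₁ = 0}: for every x = (x₁, x₂) ∈ ℝ² with x₁ + x₂ + 0.1 ≠ 0, there exist T ≥ 0 and a differentiable curve γ = (γ₁, γ₂) : ℝ → ℝ² such that γ(0) = x, ‖γ'(t)‖ ≤ |γ₁(t) + γ₂(t) + 0.1| for all t ∈ [0,T], and γ₁(T) = 0. (For instance, the curve moving in the direction ±(−1,1)/√2, which keeps the quantity γ₁ + γ₂ + 0.1 constant while driving γ₁ to 0, reaches the target in finite time.) -/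
/-- Fan dynamics `f(x,a) = |x₁ + x₂ + 0.1| a`, `‖a‖ ≤ 1`, target `{x₁ = 0}`: from
every point off the degeneracy line `x₁ + x₂ + 0.1 = 0` there is an admissible
differentiable trajectory (speed at most `|γ₁ + γ₂ + 0.1|`) reaching the target
in finite time. -/
theorem fan_target_reachable (x₁ x₂ : ℝ) (h : x₁ + x₂ + 0.1 ≠ 0) :
    ∃ T : ℝ, 0 ≤ T ∧ ∃ γ₁ γ₂ : ℝ → ℝ,
      Differentiable ℝ γ₁ ∧ Differentiable ℝ γ₂ ∧
      γ₁ 0 = x₁ ∧ γ₂ 0 = x₂ ∧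
      (∀ t ∈ Set.Icc (0:ℝ) T,
        Real.sqrt ((deriv γ₁ t)^2 + (deriv γ₂ t)^2) ≤ |γ₁ t + γ₂ t + 0.1|) ∧
      γ₁ T = 0 := by
  set s := x₁ + x₂ + 0.1
  have hs : 0 < |s| := abs_pos.mpr h
  set T := 2 * |x₁| / |s| + 1 with hT
  have hTpos : 0 < T := by positivity
  have hderiv (a b t : ℝ) : HasDerivAt (fun u => a + b * u) b t := by
    simpa using ((hasDerivAt_id t).const_mul b).const_add a
  have hspeed : 2 * |x₁ / T| ≤ |s| := by
    rw [abs_div, abs_of_pos hTpos, ← mul_div_assoc, div_le_iff₀ hTpos, hT]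
    have : |s| * (2 * |x₁| / |s| + 1) = 2 * |x₁| + |s| := by field_simp
    linarith
  refine ⟨T, hTpos.le, fun t => x₁ + -(x₁ / T) * t, fun t => x₂ + x₁ / T * t,
    fun t => (hderiv _ _ t).differentiableAt, fun t => (hderiv _ _ t).differentiableAt,
    by simp, by simp, fun t _ => ?_, by field_simp; ring⟩
  have hconst : x₁ + -(x₁ / T) * t + (x₂ + x₁ / T * t) + 0.1 = s := by ring
  rw [(hderiv _ _ t).deriv, (hderiv _ _ t).deriv, hconst, Real.sqrt_le_left hs.le]
  nlinarith [sq_abs (x₁ / T), abs_nonneg (x₁ / T)]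
end

section
/- For the three-dimensional Brockett (nonholonomic integrator) dynamics f(x, a) = (a₁, a₂, x₁·a₂ − x₂·a₁) with controls (a₁,a₂) ∈ [−5,5]²: for every x ∈ ℝ³ there exist T ≥ 0 and a differentiable curve γ = (γ₁, γ₂, γ₃) : ℝ → ℝ³ such that γ(0) = x, and for all t ∈ [0,T]: |γ₁'(t)| ≤ 5, |γ₂'(t)| ≤ 5, γ₃'(t) = γ₁(t)·γ₂'(t) − γ₂(t)·γ₁'(t), and ‖γ(T)‖ ≤ 1/4. That is, the target ball B₃(0, 0.25) is reachable in finite time from every point of ℝ³, so the minimum time function of the Brockett problem is finite everywhere. -/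
/-- The derivative of a curve traversed at constant speed `1 / T`. -/
theorem HasDerivAt.comp_div_const {f : ℝ → ℝ} {f' T t : ℝ} (hf : HasDerivAt f f' (t / T)) :
    HasDerivAt (fun u => f (u / T)) (f' / T) t := by
  have h := hf.comp t ((hasDerivAt_id t).div_const T)
  simpa [Function.comp_def, div_eq_mul_inv] using h

/-- A horizontal curve on `[0, 1]` that ends at the origin and whose first two velocity components
are bounded by `5 * T` becomes an admissible trajectory after slowing it down by the factor `T`. -/
theorem exists_admissible_of_horizontal {T : ℝ} (hT : 0 < T) {f g h f' g' : ℝ → ℝ}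
    (hf : ∀ s, HasDerivAt f (f' s) s) (hg : ∀ s, HasDerivAt g (g' s) s)
    (hh : ∀ s, HasDerivAt h (f s * g' s - g s * f' s) s)
    (hf_bd : ∀ s ∈ Set.Icc (0 : ℝ) 1, |f' s| ≤ 5 * T)
    (hg_bd : ∀ s ∈ Set.Icc (0 : ℝ) 1, |g' s| ≤ 5 * T)
    (hf_one : f 1 = 0) (hg_one : g 1 = 0) (hh_one : h 1 = 0) :
    ∃ T : ℝ, 0 ≤ T ∧ ∃ γ₁ γ₂ γ₃ : ℝ → ℝ,
      Differentiable ℝ γ₁ ∧ Differentiable ℝ γ₂ ∧ Differentiable ℝ γ₃ ∧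
      γ₁ 0 = f 0 ∧ γ₂ 0 = g 0 ∧ γ₃ 0 = h 0 ∧
      (∀ t ∈ Set.Icc (0:ℝ) T,
        |deriv γ₁ t| ≤ 5 ∧ |deriv γ₂ t| ≤ 5 ∧
        deriv γ₃ t = γ₁ t * deriv γ₂ t - γ₂ t * deriv γ₁ t) ∧
      Real.sqrt ((γ₁ T)^2 + (γ₂ T)^2 + (γ₃ T)^2) ≤ 1/4 := by
  have hF t := (hf (t / T)).comp_div_const
  have hG t := (hg (t / T)).comp_div_const
  have hH t := (hh (t / T)).comp_div_const
  refine ⟨T, hT.le, fun t => f (t / T), fun t => g (t / T), fun t => h (t / T),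
    fun t => (hF t).differentiableAt, fun t => (hG t).differentiableAt,
    fun t => (hH t).differentiableAt, by simp, by simp, by simp, fun t ht => ?_, ?_⟩
  · have hs : t / T ∈ Set.Icc (0 : ℝ) 1 :=
      ⟨div_nonneg ht.1 hT.le, (div_le_one hT).2 ht.2⟩
    rw [(hF t).deriv, (hG t).deriv, (hH t).deriv, abs_div, abs_div, abs_of_pos hT,
      div_le_iff₀ hT, div_le_iff₀ hT]
    exact ⟨hf_bd _ hs, hg_bd _ hs, by ring⟩
  · simp [div_self hT.ne', hf_one, hg_one, hh_one]

/-- Brockett (nonholonomic integrator) dynamics `f(x,a) = (a₁, a₂, x₁ a₂ - x₂ a₁)`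
with controls `(a₁,a₂) ∈ [-5,5]²`: from every point of `ℝ³` there is an admissible
differentiable trajectory reaching the target ball `B₃(0, 0.25)` in finite time. -/
theorem brockett_target_reachable (x₁ x₂ x₃ : ℝ) :
    ∃ T : ℝ, 0 ≤ T ∧ ∃ γ₁ γ₂ γ₃ : ℝ → ℝ,
      Differentiable ℝ γ₁ ∧ Differentiable ℝ γ₂ ∧ Differentiable ℝ γ₃ ∧
      γ₁ 0 = x₁ ∧ γ₂ 0 = x₂ ∧ γ₃ 0 = x₃ ∧
      (∀ t ∈ Set.Icc (0:ℝ) T,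
        |deriv γ₁ t| ≤ 5 ∧ |deriv γ₂ t| ≤ 5 ∧
        deriv γ₃ t = γ₁ t * deriv γ₂ t - γ₂ t * deriv γ₁ t) ∧
      Real.sqrt ((γ₁ T)^2 + (γ₂ T)^2 + (γ₃ T)^2) ≤ 1/4 := by
  set c : ℝ := 10 * x₂ - 30 * x₃ with hc
  have hT : 0 < |x₁| + |x₂| + 3 * |c| + 1 := by positivity
  have hf (s : ℝ) : HasDerivAt (fun s : ℝ => (1 - s) * (x₁ + s)) (1 - x₁ - 2 * s) s := by
    have := ((hasDerivAt_id s).const_sub 1).mul ((hasDerivAt_id s).const_add x₁)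
    exact this.congr_deriv (by simp only [id]; ring)
  have hq (s : ℝ) : HasDerivAt (fun s : ℝ => x₂ + c * (s ^ 2 - s / 2)) (c * (2 * s - 1 / 2)) s := by
    have := (((hasDerivAt_id s).pow 2).sub ((hasDerivAt_id s).div_const 2)).const_mul c
      |>.const_add x₂
    exact this.congr_deriv (by simp)
  have hg (s : ℝ) : HasDerivAt (fun s : ℝ => (1 - s) * (x₂ + c * (s ^ 2 - s / 2)))
      ((1 - s) * (c * (2 * s - 1 / 2)) - (x₂ + c * (s ^ 2 - s / 2))) s := by
    have := ((hasDerivAt_id s).const_sub 1).mul (hq s)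
    exact this.congr_deriv (by simp only [id]; ring)
  have hmono (a : ℝ) (n : ℕ) (s : ℝ) :
      HasDerivAt (fun s : ℝ => a / (n + 1) * s ^ (n + 1)) (a * s ^ n) s := by
    refine ((hasDerivAt_pow (n + 1) s).const_mul (a / (n + 1))).congr_deriv ?_
    have : (n : ℝ) + 1 ≠ 0 := by positivity
    push_cast
    field_simp
  -- The third component is `x₃` plus the integral of
  -- `(1 - s) ^ 2 * (-x₁ * c / 2 - x₂ + 2 * c * x₁ * s + c * s ^ 2)`.
  have hh (s : ℝ) := (((((hmono (-x₁ * c / 2 - x₂) 0 s).add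
    (hmono (2 * c * x₁ - 2 * (-x₁ * c / 2 - x₂)) 1 s)).add
    (hmono (c - 4 * c * x₁ + (-x₁ * c / 2 - x₂)) 2 s)).add
    (hmono (2 * c * x₁ - 2 * c) 3 s)).add (hmono c 4 s)).const_add x₃
  have key := exists_admissible_of_horizontal hT hf hg
    (fun s => (hh s).congr_deriv (by ring)) ?_ ?_ (by simp) (by simp)
    (by simp only [Pi.add_apply]; norm_num; rw [hc]; ring)
  · simpa using key
  · rintro s ⟨h0, h1⟩
    rw [abs_le]
    constructor <;>
      linarith [neg_abs_le x₁, le_abs_self x₁, abs_nonneg x₁, abs_nonneg x₂, abs_nonneg c]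
  · rintro s ⟨h0, h1⟩
    have hcoef : |(1 - s) * (2 * s - 1 / 2) - (s ^ 2 - s / 2)| ≤ 3 := by
      rw [abs_le]
      constructor <;> nlinarith
    calc |(1 - s) * (c * (2 * s - 1 / 2)) - (x₂ + c * (s ^ 2 - s / 2))|
        = |c * ((1 - s) * (2 * s - 1 / 2) - (s ^ 2 - s / 2)) - x₂| := by congr 1; ring
      _ ≤ |c| * |(1 - s) * (2 * s - 1 / 2) - (s ^ 2 - s / 2)| + |x₂| := by
        rw [← abs_mul]; exact abs_sub _ _
      _ ≤ |c| * 3 + |x₂| := by gcongr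
      _ ≤ 5 * (|x₁| + |x₂| + 3 * |c| + 1) := by
        linarith [abs_nonneg x₁, abs_nonneg x₂, abs_nonneg c]
end

section
/- Let E be a real inner product space (e.g. EuclideanSpace ℝ (Fin d)), let φ : E → ℝ be differentiable, and let g : E → E. Assume the inward-pointing condition: for every z ∈ E with φ(z) = 0, the derivative of φ at z applied to g(z) is strictly negative (i.e. ⟨∇φ(z), g(z)⟩ < 0). If y : ℝ → E is differentiable with y'(t) = g(y(t)) for all t ≥ 0 and φ(y(0)) ≤ 0, then φ(y(t)) ≤ 0 for all t ≥ 0. In other words, the sublevel set P = {φ ≤ 0} is positively invariant for the vector field g. -/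
/-- Patch invariance (Ancona–Bressan patches as sublevel sets): if `φ` is
differentiable, `g` points strictly inward on the boundary `{φ = 0}` (i.e.
`Dφ(z)(g(z)) < 0` whenever `φ(z) = 0`), then the sublevel set `{φ ≤ 0}` is
positively invariant for the flow of `g`: any solution `y' = g(y)` on `[0,∞)`
starting in `{φ ≤ 0}` stays in `{φ ≤ 0}`. -/
theorem patch_positively_invariant {E : Type*} [NormedAddCommGroup E]
    [InnerProductSpace ℝ E]
    (φ : E → ℝ) (hφ : Differentiable ℝ φ) (g : E → E)
    (hin : ∀ z : E, φ z = 0 → fderiv ℝ φ z (g z) < 0)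
    (y : ℝ → E) (hy : Differentiable ℝ y)
    (hsys : ∀ t : ℝ, 0 ≤ t → deriv y t = g (y t))
    (h0 : φ (y 0) ≤ 0) :
    ∀ t : ℝ, 0 ≤ t → φ (y t) ≤ 0 := by
  intro t ht
  have hderiv : ∀ s : ℝ, HasDerivAt (fun s => φ (y s)) (fderiv ℝ φ (y s) (deriv y s)) s :=
    fun s => (hφ (y s)).hasFDerivAt.comp_hasDerivAt s (hy s).hasDerivAt
  refine image_le_of_deriv_right_lt_deriv_boundary (f := fun s => φ (y s)) (a := 0) (b := t)
    (B := fun _ => 0) (B' := fun _ => 0) (hφ.comp hy).continuous.continuousOn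
    (fun s _ => (hderiv s).hasDerivWithinAt) h0 (fun s => hasDerivAt_const s 0) ?_
    (Set.right_mem_Icc.2 ht)
  intro s hs hzero
  rw [hsys s hs.1]
  exact hin (y s) hzero
end
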